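/- The Stokeslet solves the homogeneous steady Stokes equations away from the origin: define the pressure fields P_i(x) := ω_{d−1}^{−1} x_i ‖x‖^{−d} for i ∈ {1,…,d}. Then for every i, j ∈ {1,…,d} and every x ∈ ℝ^d with x ≠ 0, Δ𝒢_{ij}(x) = ∂_j P_i(x), where Δ denotes the Laplacian (the sum of the second partial derivatives); equivalently, −Δ𝒢_i + ∇P_i = 0 on ℝ^d∖{0} for each row 𝒢_i of the Stokeslet. -/

import Mathlib

open MeasureTheory

/-- Surface area `ω_{d−1}` of the unit sphere in `ℝ^d`, i.e. `d` times the Lebesgue volume of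
the unit ball. -/
noncomputable def sphereArea (d : ℕ) : ℝ :=
  d * (volume (Metric.ball (0 : EuclideanSpace ℝ (Fin d)) 1)).toReal

/-- The Stokeslet `𝒢 : ℝ^d ∖ {0} → ℝ^{d×d}`, i.e. the Green's function of the steady Stokes
equations: `𝒢_{ij}(x) = (2(d−2)ω_{d−1})⁻¹ ‖x‖^{2−d} (δ_{ij} + (d−2) xᵢ xⱼ ‖x‖⁻²)`. -/
noncomputable def stokeslet (d : ℕ) (x : EuclideanSpace ℝ (Fin d)) : Fin d → Fin d → ℝ :=
  fun i j => (2 * ((d : ℝ) - 2) * sphereArea d)⁻¹ * ‖x‖ ^ ((2 : ℝ) - d) *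
    ((if i = j then (1 : ℝ) else 0) + ((d : ℝ) - 2) * x i * x j / ‖x‖ ^ 2)

/-- The pressure field associated with the Stokeslet: `P_i(x) = ω_{d−1}⁻¹ xᵢ ‖x‖^{−d}`. -/
noncomputable def stokesPressure (d : ℕ) (i : Fin d) (x : EuclideanSpace ℝ (Fin d)) : ℝ :=
  (sphereArea d)⁻¹ * x i * ‖x‖ ^ (-(d : ℝ))

section StokesletDerivatives

variable {d : ℕ}

/-- Away from the origin, `‖·‖ ^ p` has derivative `p ‖y‖ ^ (p - 2) ⟪y, ·⟫`. -/
lemma hasFDerivAt_norm_rpow_of_ne_zero {E : Type*} [NormedAddCommGroup E] [InnerProductSpace ℝ E]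
    (p : ℝ) {y : E} (hy : y ≠ 0) :
    HasFDerivAt (fun z : E => ‖z‖ ^ p) ((p * ‖y‖ ^ (p - 2)) • innerSL ℝ y) y := by
  have hpow (z : E) (q : ℝ) : (‖z‖ ^ 2) ^ q = ‖z‖ ^ (2 * q) := by
    rw [← Real.rpow_natCast, ← Real.rpow_mul (norm_nonneg z)]
    norm_num
  have h := (hasStrictFDerivAt_norm_sq y).hasFDerivAt.rpow_const (p := p / 2)
    (Or.inl (by positivity))
  have hp : 2 * (p / 2) = p := by ring
  have hp' : 2 * (p / 2 - 1) = p - 2 := by ring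
  simp only [hpow, hp, hp'] at h
  convert h using 1
  ext v
  simp
  ring

lemma EuclideanSpace.hasFDerivAt_apply (i : Fin d) (y : EuclideanSpace ℝ (Fin d)) :
    HasFDerivAt (fun z : EuclideanSpace ℝ (Fin d) => z i)
      (EuclideanSpace.proj i : EuclideanSpace ℝ (Fin d) →L[ℝ] ℝ) y :=
  (EuclideanSpace.proj i : EuclideanSpace ℝ (Fin d) →L[ℝ] ℝ).hasFDerivAt

lemma stokeslet_eq_of_ne_zero (i j : Fin d) {y : EuclideanSpace ℝ (Fin d)} (hy : y ≠ 0) :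
    stokeslet d y i j = (2 * ((d : ℝ) - 2) * sphereArea d)⁻¹ *
      ((if i = j then (1 : ℝ) else 0) * ‖y‖ ^ ((2 : ℝ) - d) +
        ((d : ℝ) - 2) * (y i * y j * ‖y‖ ^ (-(d : ℝ)))) := by
  have hr : 0 < ‖y‖ := norm_pos_iff.2 hy
  have h : ‖y‖ ^ ((2 : ℝ) - d) = ‖y‖ ^ (-(d : ℝ)) * ‖y‖ ^ 2 := by
    rw [← Real.rpow_natCast, ← Real.rpow_add hr]
    congr 1
    push_cast
    ring
  rw [stokeslet, h]
  field_simp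

lemma fderiv_stokeslet_single (i j k : Fin d) {y : EuclideanSpace ℝ (Fin d)} (hy : y ≠ 0) :
    fderiv ℝ (fun z : EuclideanSpace ℝ (Fin d) => stokeslet d z i j) y
        (EuclideanSpace.single k 1) =
      (2 * ((d : ℝ) - 2) * sphereArea d)⁻¹ *
        ((if i = j then (1 : ℝ) else 0) * (2 - d) * (y k * ‖y‖ ^ (-(d : ℝ))) +
          ((d : ℝ) - 2) * (((if i = k then (1 : ℝ) else 0) * y j +
            (if j = k then (1 : ℝ) else 0) * y i) * ‖y‖ ^ (-(d : ℝ)) -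
            d * (y i * y j * y k * ‖y‖ ^ (-(d : ℝ) - 2)))) := by
  have heq : (fun z : EuclideanSpace ℝ (Fin d) => stokeslet d z i j) =ᶠ[nhds y] fun z =>
      (2 * ((d : ℝ) - 2) * sphereArea d)⁻¹ *
        ((if i = j then (1 : ℝ) else 0) * ‖z‖ ^ ((2 : ℝ) - d) +
          ((d : ℝ) - 2) * (z i * z j * ‖z‖ ^ (-(d : ℝ)))) := by
    filter_upwards [isOpen_ne.mem_nhds hy] with z hz using stokeslet_eq_of_ne_zero i j hz
  have h := (((hasFDerivAt_norm_rpow_of_ne_zero ((2 : ℝ) - d) hy).const_mul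
    (if i = j then (1 : ℝ) else 0)).add
      ((((EuclideanSpace.hasFDerivAt_apply i y).mul (EuclideanSpace.hasFDerivAt_apply j y)).mul
        (hasFDerivAt_norm_rpow_of_ne_zero (-(d : ℝ)) hy)).const_mul ((d : ℝ) - 2))).const_mul
          (2 * ((d : ℝ) - 2) * sphereArea d)⁻¹
  have hexp : (2 : ℝ) - d - 2 = -d := by ring
  rw [(h.congr_of_eventuallyEq heq).fderiv, hexp]
  simp only [add_apply, smul_apply, smul_eq_mul,
    innerSL_apply_apply, EuclideanSpace.inner_single_right, PiLp.proj_apply,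
    PiLp.single_apply, Pi.mul_apply, conj_trivial, one_mul]
  ring

lemma fderiv_stokesPressure_single (i j : Fin d) {x : EuclideanSpace ℝ (Fin d)} (hx : x ≠ 0) :
    fderiv ℝ (stokesPressure d i) x (EuclideanSpace.single j 1) =
      (sphereArea d)⁻¹ * ((if i = j then (1 : ℝ) else 0) * ‖x‖ ^ (-(d : ℝ)) -
        d * (x i * x j * ‖x‖ ^ (-(d : ℝ) - 2))) := by
  have h := ((EuclideanSpace.hasFDerivAt_apply i x).const_mul (sphereArea d)⁻¹).mul
    (hasFDerivAt_norm_rpow_of_ne_zero (-(d : ℝ)) hx)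
  rw [HasFDerivAt.fderiv (f := stokesPressure d i) h]
  simp only [add_apply, smul_apply, smul_eq_mul,
    innerSL_apply_apply, EuclideanSpace.inner_single_right, PiLp.proj_apply,
    PiLp.single_apply, conj_trivial, one_mul]
  ring

lemma fderiv_fderiv_stokeslet_single (i j k : Fin d) {x : EuclideanSpace ℝ (Fin d)}
    (hx : x ≠ 0) :
    fderiv ℝ (fun y : EuclideanSpace ℝ (Fin d) =>
        fderiv ℝ (fun z : EuclideanSpace ℝ (Fin d) => stokeslet d z i j) y
          (EuclideanSpace.single k 1)) x (EuclideanSpace.single k 1) =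
      (2 * ((d : ℝ) - 2) * sphereArea d)⁻¹ *
        ((if i = j then (1 : ℝ) else 0) * (2 - d) *
            (‖x‖ ^ (-(d : ℝ)) - d * (x k ^ 2 * ‖x‖ ^ (-(d : ℝ) - 2))) +
          ((d : ℝ) - 2) * (
            2 * ((if i = k then (1 : ℝ) else 0) * (if j = k then (1 : ℝ) else 0)) *
              ‖x‖ ^ (-(d : ℝ)) -
            2 * d * ((if i = k then (1 : ℝ) else 0) * x k * x j +
              (if j = k then (1 : ℝ) else 0) * x k * x i) * ‖x‖ ^ (-(d : ℝ) - 2) -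
            d * (x i * x j * ‖x‖ ^ (-(d : ℝ) - 2)) +
            d * (d + 2) * (x i * x j * x k ^ 2 * ‖x‖ ^ (-(d : ℝ) - 2 - 2)))) := by
  have heq := Filter.eventually_of_mem (isOpen_ne.mem_nhds hx)
    fun y hy => fderiv_stokeslet_single i j k hy
  have hi := EuclideanSpace.hasFDerivAt_apply i x
  have hj := EuclideanSpace.hasFDerivAt_apply j x
  have hk := EuclideanSpace.hasFDerivAt_apply k x
  have hd := hasFDerivAt_norm_rpow_of_ne_zero (-(d : ℝ)) hx
  have hd₂ := hasFDerivAt_norm_rpow_of_ne_zero (-(d : ℝ) - 2) hx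
  have h := (((hk.mul hd).const_mul ((if i = j then (1 : ℝ) else 0) * (2 - d))).add
    (((((hj.const_mul (if i = k then (1 : ℝ) else 0)).add
      (hi.const_mul (if j = k then (1 : ℝ) else 0))).mul hd).sub
        ((((hi.mul hj).mul hk).mul hd₂).const_mul (d : ℝ))).const_mul ((d : ℝ) - 2))).const_mul
          (2 * ((d : ℝ) - 2) * sphereArea d)⁻¹
  rw [(h.congr_of_eventuallyEq heq).fderiv]
  simp only [add_apply, sub_apply,
    smul_apply, smul_eq_mul,
    innerSL_apply_apply, EuclideanSpace.inner_single_right, PiLp.proj_apply,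
    PiLp.single_apply, Pi.mul_apply, Pi.add_apply, conj_trivial, one_mul, if_true]
  ring

end StokesletDerivatives

/-- **The Stokeslet solves the homogeneous steady Stokes equations away from the origin:**
for all `i, j` and all `x ≠ 0`, `Δ𝒢_{ij}(x) = ∂_j P_i(x)`, the Laplacian being the sum of the
second partial derivatives; equivalently `−Δ𝒢_i + ∇P_i = 0` on `ℝ^d ∖ {0}`. -/
theorem stokeslet_solves_stokes (d : ℕ) (hd : 3 ≤ d) (i j : Fin d)
    (x : EuclideanSpace ℝ (Fin d)) (hx : x ≠ 0) :
    ∑ k : Fin d,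
      fderiv ℝ (fun y : EuclideanSpace ℝ (Fin d) =>
          fderiv ℝ (fun z : EuclideanSpace ℝ (Fin d) => stokeslet d z i j) y
            (EuclideanSpace.single k 1)) x (EuclideanSpace.single k 1)
      = fderiv ℝ (stokesPressure d i) x (EuclideanSpace.single j 1) := by
  have hr : 0 < ‖x‖ := norm_pos_iff.2 hx
  have hsum : ∑ k, x k ^ 2 = ‖x‖ ^ 2 := (EuclideanSpace.real_norm_sq_eq x).symm
  have hshift (q : ℝ) : ‖x‖ ^ q = ‖x‖ ^ (q - 2) * ‖x‖ ^ 2 := by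
    rw [← Real.rpow_natCast ‖x‖ 2, ← Real.rpow_add hr]
    congr 1
    push_cast
    ring
  have hd2 : (d : ℝ) - 2 ≠ 0 := by
    have : (3 : ℝ) ≤ d := by exact_mod_cast hd
    linarith
  have hδ : ∑ k, (if i = k then (1 : ℝ) else 0) * (if j = k then (1 : ℝ) else 0) =
      if i = j then 1 else 0 := by
    simp
  have hδx (a : Fin d) : ∑ k, (if a = k then (1 : ℝ) else 0) * x k = x a := by simp
  simp only [fderiv_fderiv_stokeslet_single i j _ hx, fderiv_stokesPressure_single i j hx]
  simp only [← Finset.mul_sum, ← Finset.sum_mul, Finset.sum_add_distrib,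
    Finset.sum_sub_distrib, hδ, hδx, hsum, Finset.sum_const, Finset.card_univ,
    Fintype.card_fin, nsmul_eq_mul]
  rw [hshift (-(d : ℝ)), hshift (-(d : ℝ) - 2), mul_inv, mul_inv]
  field_simp
  ring
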